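/- arXiv:2604.23349 — 4 statements merged into one kernel-verified Lean document; each statement's English description precedes it below -/
import Mathlib

section
/- Let 1 ≤ k ≤ n. Then the functions λ ↦ (S_k(λ))^{1/k} and λ ↦ log S_k(λ) are concave on the convex set Γ̃_k (on which S_k > 0). -/
open scoped BigOperators
noncomputable section

/-- The `k`-th elementary symmetric function of `lam ∈ ℝⁿ`. -/
def esymm (n k : ℕ) (lam : Fin n → ℝ) : ℝ :=
  ∑ s ∈ Finset.univ.powersetCard k, ∏ i ∈ s, lam i

/-- The Gårding cone `Γ_k` (with `Γ₀ = ℝⁿ`). -/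
def GammaCone (n k : ℕ) : Set (Fin n → ℝ) :=
  {lam | ∀ i : ℕ, 1 ≤ i → i ≤ k → 0 < esymm n i lam}

/-- The cone `Γ̃_k = Γ_{k-1} ∩ {S_k = σ_k + σ_{k-1} > 0}`. -/
def GammaTilde (n k : ℕ) : Set (Fin n → ℝ) :=
  GammaCone n (k - 1) ∩ {lam | 0 < esymm n k lam + esymm n (k - 1) lam}

section RealRooted

open Polynomial

lemma Polynomial.Splits.derivative_real {p : ℝ[X]} (hp : p.Splits) : (derivative p).Splits := by
  by_cases h : p.natDegree = 0
  · rw [derivative_of_natDegree_zero h]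
    exact Splits.zero
  · have h1 := card_roots_le_derivative p
    have h2 := natDegree_derivative_lt h
    have h3 := card_roots' (derivative p)
    rw [← hp.natDegree_eq_card_roots] at h1
    exact splits_iff_card_roots.2 (by omega)

lemma Polynomial.Splits.iterate_derivative_real {p : ℝ[X]} (hp : p.Splits) (k : ℕ) :
    (derivative^[k] p).Splits := by
  induction k with
  | zero => exact hp
  | succ k ih =>
    rw [Function.iterate_succ_apply']
    exact ih.derivative_real

/-- The Laguerre inequality for real-rooted polynomials. -/
lemma Polynomial.Splits.laguerre_inequality {p : ℝ[X]} (hp : p.Splits) (x : ℝ) :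
    p.eval x * (derivative (derivative p)).eval x ≤ (derivative p).eval x ^ 2 := by
  induction hp using Submonoid.closure_induction with
  | mem p hp =>
    rcases hp with ⟨a, rfl⟩ | ⟨a, rfl⟩ <;> simp
  | one => simp
  | mul p q _ _ hp hq =>
    simp only [derivative_mul, derivative_add, eval_add, eval_mul]
    nlinarith [mul_nonneg (sub_nonneg.2 hp) (sq_nonneg (q.eval x)),
      mul_nonneg (sub_nonneg.2 hq) (sq_nonneg (p.eval x))]

/-- Newton's inequality for the coefficients of a real-rooted polynomial. -/
lemma Polynomial.Splits.coeff_mul_coeff_le_sq {p : ℝ[X]} (hp : p.Splits) (k : ℕ) :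
    p.coeff k * p.coeff (k + 2) ≤ p.coeff (k + 1) ^ 2 := by
  have h := (hp.iterate_derivative_real k).laguerre_inequality 0
  simp only [← coeff_zero_eq_eval_zero, coeff_derivative, coeff_iterate_derivative,
    nsmul_eq_mul] at h
  have h1 : (0 + 1 + k).descFactorial k = (k + 1).factorial := by
    rw [Nat.descFactorial_eq_div (by omega)]
    simp [add_comm]
  have h2 : 2 * (0 + 1 + 1 + k).descFactorial k = (k + 2).factorial := by
    have := Nat.factorial_mul_descFactorial (n := 0 + 1 + 1 + k) (k := k) (by omega)
    rw [show 0 + 1 + 1 + k - k = 2 by omega, show 0 + 1 + 1 + k = k + 2 by omega] at this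
    rw [show 0 + 1 + 1 + k = k + 2 by omega, ← this]
    rfl
  have h0 : (0 + k).descFactorial k = k.factorial := by
    simp [Nat.descFactorial_self]
  have h2' : (2 : ℝ) * ((0 + 1 + 1 + k).descFactorial k : ℝ) = (k + 2) * ((k + 1) * k.factorial) := by
    exact_mod_cast h2
  have h1' : ((0 + 1 + k).descFactorial k : ℝ) = (k + 1) * k.factorial := by
    rw [h1]; push_cast [Nat.factorial_succ]; ring
  rw [h1', h0, show 0 + 1 + 1 + k = k + 2 by omega, show 0 + 1 + k = k + 1 by omega,
    show 0 + k = k by omega] at h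
  rw [show 0 + 1 + 1 + k = k + 2 by omega] at h2'
  push_cast at h
  have hf : (0 : ℝ) < (k.factorial : ℝ) ^ 2 * (k + 1) := by positivity
  have key : (k.factorial : ℝ) ^ 2 * (k + 1) * ((k + 2) * (p.coeff k * p.coeff (k + 2))) ≤
      (k.factorial : ℝ) ^ 2 * (k + 1) * ((k + 1) * p.coeff (k + 1) ^ 2) := by
    linear_combination h + k.factorial * p.coeff k * p.coeff (k + 2) * (-h2')
  have key' := le_of_mul_le_mul_left key hf
  have hk : (0 : ℝ) ≤ k := k.cast_nonneg
  rcases le_or_gt (p.coeff k * p.coeff (k + 2)) 0 with hn | hn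
  · exact hn.trans (sq_nonneg _)
  · nlinarith

end RealRooted

section ElementarySymmetric

variable {ι : Type*}

/-- The `k`-th elementary symmetric function of the variables indexed by `s`. -/
def elemSymm (s : Finset ι) (k : ℕ) (x : ι → ℝ) : ℝ :=
  ∑ t ∈ s.powersetCard k, ∏ i ∈ t, x i

@[simp] lemma elemSymm_zero (s : Finset ι) (x : ι → ℝ) : elemSymm s 0 x = 1 := by
  simp [elemSymm]

lemma elemSymm_one (s : Finset ι) (x : ι → ℝ) : elemSymm s 1 x = ∑ i ∈ s, x i := by
  simp [elemSymm, Finset.powersetCard_one]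

@[simp] lemma elemSymm_empty_succ (k : ℕ) (x : ι → ℝ) : elemSymm ∅ (k + 1) x = 0 := by
  rw [elemSymm, Finset.powersetCard_eq_empty.2 (by simp), Finset.sum_empty]

lemma elemSymm_map {κ : Type*} (f : κ ↪ ι) (s : Finset κ) (k : ℕ) (x : ι → ℝ) :
    elemSymm (s.map f) k x = elemSymm s k (x ∘ f) := by
  simp [elemSymm, Finset.powersetCard_map]

variable [DecidableEq ι]

lemma elemSymm_insert {a : ι} {s : Finset ι} (ha : a ∉ s) (k : ℕ) (x : ι → ℝ) :
    elemSymm (insert a s) (k + 1) x = elemSymm s (k + 1) x + x a * elemSymm s k x := by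
  have hmem : ∀ t ∈ s.powersetCard k, a ∉ t := fun t ht h =>
    ha ((Finset.mem_powersetCard.1 ht).1 h)
  simp only [elemSymm]
  rw [Finset.powersetCard_succ_insert ha, Finset.sum_union, Finset.sum_image, Finset.mul_sum]
  · congr 1
    exact Finset.sum_congr rfl fun t ht => Finset.prod_insert (hmem t ht)
  · intro t ht u hu h
    rw [← Finset.erase_insert (hmem t ht), ← Finset.erase_insert (hmem u hu), h]
  · refine Finset.disjoint_left.2 fun t ht hu => ?_
    obtain ⟨u, -, rfl⟩ := Finset.mem_image.1 hu
    exact ha ((Finset.mem_powersetCard.1 ht).1 (Finset.mem_insert_self a u))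

lemma elemSymm_erase {i : ι} {s : Finset ι} (hi : i ∈ s) (k : ℕ) (x : ι → ℝ) :
    elemSymm s (k + 1) x = elemSymm (s.erase i) (k + 1) x + x i * elemSymm (s.erase i) k x := by
  conv_lhs => rw [← Finset.insert_erase hi]
  exact elemSymm_insert (Finset.notMem_erase i s) k x

lemma sum_mul_elemSymm_erase (s : Finset ι) (k : ℕ) (x : ι → ℝ) :
    ∑ i ∈ s, x i * elemSymm (s.erase i) k x = (k + 1) * elemSymm s (k + 1) x := by
  induction s using Finset.induction_on generalizing k with
  | empty => simp
  | insert a s ha ih =>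
    cases k with
    | zero => simp [elemSymm_one]
    | succ k =>
      have h : ∀ i ∈ s, x i * elemSymm ((insert a s).erase i) (k + 1) x =
          x i * elemSymm (s.erase i) (k + 1) x + x a * (x i * elemSymm (s.erase i) k x) := by
        intro i hi
        rw [Finset.erase_insert_of_ne (by rintro rfl; exact ha hi),
          elemSymm_insert (fun h => ha (Finset.mem_of_mem_erase h))]
        ring
      rw [Finset.sum_insert ha, Finset.erase_insert ha, Finset.sum_congr rfl h,
        Finset.sum_add_distrib, ← Finset.mul_sum, ih, ih, elemSymm_insert ha]
      push_cast
      ring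

open Polynomial in
lemma coeff_prod_one_add_C_mul_X (s : Finset ι) (k : ℕ) (x : ι → ℝ) :
    (∏ i ∈ s, (1 + C (x i) * X)).coeff k = elemSymm s k x := by
  induction s using Finset.induction_on generalizing k with
  | empty => cases k <;> simp [coeff_one]
  | insert a s ha ih =>
    rw [Finset.prod_insert ha, add_mul, one_mul, mul_assoc, coeff_add, coeff_C_mul, ih]
    cases k with
    | zero => simp
    | succ k => rw [coeff_X_mul, ih, elemSymm_insert ha]

/-- A weak form of Newton's inequality. -/
lemma elemSymm_mul_le_sq (s : Finset ι) (k : ℕ) (x : ι → ℝ) :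
    elemSymm s k x * elemSymm s (k + 2) x ≤ elemSymm s (k + 1) x ^ 2 := by
  simp only [← coeff_prod_one_add_C_mul_X]
  refine (Polynomial.Splits.prod fun i _ => ?_).coeff_mul_coeff_le_sq k
  refine Polynomial.Splits.of_natDegree_le_one ?_
  compute_degree

/-- The Gårding cone in the variables indexed by `s`. -/
def gardingCone (s : Finset ι) (k : ℕ) : Set (ι → ℝ) :=
  {x | ∀ i ≤ k, 0 < elemSymm s i x}

omit [DecidableEq ι] in
lemma mem_gardingCone_succ {s : Finset ι} {k : ℕ} {x : ι → ℝ} :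
    x ∈ gardingCone s (k + 1) ↔ x ∈ gardingCone s k ∧ 0 < elemSymm s (k + 1) x := by
  simp only [gardingCone, Set.mem_ofPred_eq, Nat.le_succ_iff]
  grind

lemma mem_gardingCone_erase {s : Finset ι} {i : ι} (hi : i ∈ s) {k : ℕ} {x : ι → ℝ}
    (hx : x ∈ gardingCone s (k + 1)) : x ∈ gardingCone (s.erase i) k := by
  induction k with
  | zero =>
    intro j hj
    simp [Nat.le_zero.1 hj]
  | succ k ih =>
    rw [mem_gardingCone_succ] at hx
    have h := ih hx.1
    refine mem_gardingCone_succ.2 ⟨h, ?_⟩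
    have h0 := h k le_rfl
    have h1 := hx.1 (k + 1) le_rfl
    have h2 := hx.2
    rw [elemSymm_erase hi] at h1 h2
    have hN := elemSymm_mul_le_sq (s.erase i) k x
    by_contra! hneg
    nlinarith [mul_nonneg h1.le (neg_nonneg.2 hneg), mul_pos h2 h0]

/-- The quotient of consecutive elementary symmetric functions. -/
def elemSymmQuot (s : Finset ι) (k : ℕ) (x : ι → ℝ) : ℝ :=
  elemSymm s (k + 1) x / elemSymm s k x

omit [DecidableEq ι] in
lemma elemSymmQuot_pos {s : Finset ι} {k j : ℕ} (hj : j < k) {x : ι → ℝ}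
    (hx : x ∈ gardingCone s k) : 0 < elemSymmQuot s j x :=
  div_pos (hx _ hj) (hx _ hj.le)

omit [DecidableEq ι] in
lemma gardingCone_succ_eq (s : Finset ι) (k : ℕ) :
    gardingCone s (k + 1) = {x ∈ gardingCone s k | 0 < elemSymmQuot s k x} := by
  ext x
  rw [mem_gardingCone_succ]
  refine and_congr_right fun hx => ?_
  rw [elemSymmQuot, div_pos_iff_of_pos_right (hx k le_rfl)]

lemma add_elemSymmQuot_erase {s : Finset ι} {i : ι} (hi : i ∈ s) {k : ℕ} {x : ι → ℝ}
    (hx : x ∈ gardingCone s (k + 1)) :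
    x i + elemSymmQuot (s.erase i) k x = elemSymm s (k + 1) x / elemSymm (s.erase i) k x := by
  have h := (mem_gardingCone_erase hi hx k le_rfl).ne'
  rw [elemSymmQuot, elemSymm_erase hi]
  field_simp
  ring

lemma add_elemSymmQuot_erase_pos {s : Finset ι} {i : ι} (hi : i ∈ s) {k : ℕ} {x : ι → ℝ}
    (hx : x ∈ gardingCone s (k + 1)) : 0 < x i + elemSymmQuot (s.erase i) k x := by
  rw [add_elemSymmQuot_erase hi hx]
  exact div_pos (hx _ le_rfl) (mem_gardingCone_erase hi hx k le_rfl)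

/-- The Marcus–Lopes recursion. -/
lemma elemSymmQuot_succ {s : Finset ι} {k : ℕ} {x : ι → ℝ} (hx : x ∈ gardingCone s (k + 1)) :
    elemSymmQuot s (k + 1) x =
      ((k : ℝ) + 2)⁻¹ * ∑ i ∈ s, (x i - x i ^ 2 / (x i + elemSymmQuot (s.erase i) k x)) := by
  have h0 := (hx (k + 1) le_rfl).ne'
  have h : ∀ i ∈ s, x i - x i ^ 2 / (x i + elemSymmQuot (s.erase i) k x) =
      x i * elemSymm (s.erase i) (k + 1) x / elemSymm s (k + 1) x := by
    intro i hi
    have h1 := (mem_gardingCone_erase hi hx k le_rfl).ne'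
    rw [add_elemSymmQuot_erase hi hx]
    field_simp
    rw [elemSymm_erase hi]
    ring
  rw [Finset.sum_congr rfl h, ← Finset.sum_div, sum_mul_elemSymm_erase, elemSymmQuot]
  have : (k : ℝ) + 2 ≠ 0 := by positivity
  push_cast
  field_simp
  ring

lemma sq_div_le_of_concave {a b u v y z w : ℝ} (ha : 0 ≤ a) (hb : 0 ≤ b) (hab : a + b = 1)
    (hy : 0 < y) (hz : 0 < z) (hw : a * y + b * z ≤ w) :
    (a * u + b * v) ^ 2 / w ≤ a * (u ^ 2 / y) + b * (v ^ 2 / z) := by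
  have hpos : 0 < a * y + b * z := by
    rcases ha.eq_or_lt with rfl | ha
    · have : b = 1 := by linarith
      simp [this, hz]
    · positivity
  rw [div_le_iff₀ (hpos.trans_le hw)]
  have h0 : 0 ≤ a * (u ^ 2 / y) + b * (v ^ 2 / z) := by positivity
  refine le_trans ?_ (mul_le_mul_of_nonneg_left hw h0)
  have h : (a * (u ^ 2 / y) + b * (v ^ 2 / z)) * (a * y + b * z) - (a * u + b * v) ^ 2 =
      a * b * (u * z - v * y) ^ 2 / (y * z) := by
    field_simp
    ring
  have : 0 ≤ a * b * (u * z - v * y) ^ 2 / (y * z) := by positivity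
  linarith

lemma concaveOn_elemSymmQuot (s : Finset ι) (k : ℕ) :
    ConcaveOn ℝ (gardingCone s k) (elemSymmQuot s k) := by
  induction k generalizing s with
  | zero =>
    have h : gardingCone s 0 = Set.univ := by
      ext x
      simp [gardingCone]
    rw [h]
    refine ⟨convex_univ, fun x _ y _ a b _ _ _ => le_of_eq ?_⟩
    simp [elemSymmQuot, elemSymm_one, Finset.sum_add_distrib, Finset.mul_sum]
  | succ k ih =>
    have hconv : Convex ℝ (gardingCone s (k + 1)) := by
      rw [gardingCone_succ_eq]
      exact (ih s).convex_gt 0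
    refine ⟨hconv, fun x hx y hy a b ha hb hab => ?_⟩
    have hz := hconv hx hy ha hb hab
    rw [elemSymmQuot_succ hx, elemSymmQuot_succ hy, elemSymmQuot_succ hz, smul_eq_mul, smul_eq_mul,
      mul_left_comm a, mul_left_comm b, ← mul_add, Finset.mul_sum, Finset.mul_sum,
      ← Finset.sum_add_distrib]
    refine mul_le_mul_of_nonneg_left (Finset.sum_le_sum fun i hi => ?_) (by positivity)
    have hq := (ih (s.erase i)).2 (mem_gardingCone_erase hi hx) (mem_gardingCone_erase hi hy)
      ha hb hab
    simp only [smul_eq_mul, Pi.add_apply, Pi.smul_apply] at hq ⊢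
    have := sq_div_le_of_concave (u := x i) (v := y i)
      (w := a * x i + b * y i + elemSymmQuot (s.erase i) k (a • x + b • y)) ha hb hab
      (add_elemSymmQuot_erase_pos hi hx) (add_elemSymmQuot_erase_pos hi hy) (by linarith)
    linarith

omit [DecidableEq ι] in
lemma prod_elemSymmQuot {s : Finset ι} {k : ℕ} {x : ι → ℝ} (hx : x ∈ gardingCone s k) :
    ∏ j ∈ Finset.range k, elemSymmQuot s j x = elemSymm s k x := by
  induction k with
  | zero => simp
  | succ k ih =>
    have h := (mem_gardingCone_succ.1 hx).1
    have h0 := (h k le_rfl).ne'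
    rw [Finset.prod_range_succ, ih h, elemSymmQuot]
    field_simp

end ElementarySymmetric

/-- The geometric mean of positive concave functions is concave. -/
lemma ConcaveOn.prod_rpow {E κ : Type*} [AddCommGroup E] [Module ℝ E] {S : Set E} (hS : Convex ℝ S)
    (t : Finset κ) (f : κ → E → ℝ) (ht : t.Nonempty) (hf : ∀ j ∈ t, ConcaveOn ℝ S (f j))
    (hpos : ∀ j ∈ t, ∀ x ∈ S, 0 < f j x) :
    ConcaveOn ℝ S (fun x => (∏ j ∈ t, f j x) ^ ((1 : ℝ) / t.card)) := by
  refine ⟨hS, fun x hx y hy a b ha hb hab => ?_⟩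
  set z := a • x + b • y
  have hz : z ∈ S := hS hx hy ha hb hab
  have hcard : (t.card : ℝ) ≠ 0 := by exact_mod_cast ht.card_ne_zero
  have hP : 0 < (∏ j ∈ t, f j z) ^ ((1 : ℝ) / t.card) :=
    Real.rpow_pos_of_pos (Finset.prod_pos fun j hj => hpos j hj z hz) _
  have amgm : ∀ u ∈ S, (∏ j ∈ t, f j u) ^ ((1 : ℝ) / t.card) / (∏ j ∈ t, f j z) ^ ((1 : ℝ) / t.card)
      ≤ ∑ j ∈ t, (1 : ℝ) / t.card * (f j u / f j z) := by
    intro u hu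
    have h := Real.geom_mean_le_arith_mean_weighted t (fun _ => (1 : ℝ) / t.card)
      (fun j => f j u / f j z) (fun _ _ => by positivity)
      (by rw [Finset.sum_const, nsmul_eq_mul]; field_simp)
      (fun j hj => (div_pos (hpos j hj u hu) (hpos j hj z hz)).le)
    rwa [Real.finsetProd_rpow _ _
      (fun j hj => (div_pos (hpos j hj u hu) (hpos j hj z hz)).le), Finset.prod_div_distrib,
      Real.div_rpow (Finset.prod_nonneg fun j hj => (hpos j hj u hu).le)
        (Finset.prod_nonneg fun j hj => (hpos j hj z hz).le)] at h
  have hsum : a * ∑ j ∈ t, (1 : ℝ) / t.card * (f j x / f j z) +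
      b * ∑ j ∈ t, (1 : ℝ) / t.card * (f j y / f j z) ≤ 1 := by
    rw [Finset.mul_sum, Finset.mul_sum, ← Finset.sum_add_distrib]
    calc _ ≤ ∑ j ∈ t, (1 : ℝ) / t.card := Finset.sum_le_sum fun j hj => ?_
      _ = 1 := by rw [Finset.sum_const, nsmul_eq_mul]; field_simp
    have hc := (hf j hj).2 hx hy ha hb hab
    simp only [smul_eq_mul] at hc
    have hle : (a * f j x + b * f j y) / f j z ≤ 1 := (div_le_one (hpos j hj z hz)).2 hc
    calc _ = (1 : ℝ) / t.card * ((a * f j x + b * f j y) / f j z) := by ring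
      _ ≤ (1 : ℝ) / t.card * 1 := mul_le_mul_of_nonneg_left hle (by positivity)
      _ = _ := mul_one _
  have hfin := (add_le_add (mul_le_mul_of_nonneg_left (amgm x hx) ha)
    (mul_le_mul_of_nonneg_left (amgm y hy) hb)).trans hsum
  rw [← mul_div_assoc, ← mul_div_assoc, ← add_div, div_le_one hP] at hfin
  simpa only [smul_eq_mul] using hfin

lemma concaveOn_elemSymm_rpow {ι : Type*} (s : Finset ι) {k : ℕ} (hk : 1 ≤ k) :
    ConcaveOn ℝ (gardingCone s k) (fun x => elemSymm s k x ^ ((1 : ℝ) / k)) := by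
  classical
  have hsub : ∀ j ≤ k, gardingCone s k ⊆ gardingCone s j := fun j hj x hx i hi => hx i (hi.trans hj)
  have h := ConcaveOn.prod_rpow (concaveOn_elemSymmQuot s k).1 (Finset.range k) (elemSymmQuot s)
    (Finset.nonempty_range_iff.2 (by omega))
    (fun j hj => (concaveOn_elemSymmQuot s j).subset (hsub j (Finset.mem_range.1 hj).le)
      (concaveOn_elemSymmQuot s k).1)
    (fun j hj x hx => elemSymmQuot_pos (Finset.mem_range.1 hj) hx)
  rw [Finset.card_range] at h
  exact h.congr fun x hx => by simp only [prod_elemSymmQuot hx]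

lemma ConcaveOn.log_of_rpow {E : Type*} [AddCommGroup E] [Module ℝ E] {S : Set E} {f : E → ℝ}
    {p : ℝ} (hp : 0 < p) (hf : ConcaveOn ℝ S (fun x => f x ^ p)) (hpos : ∀ x ∈ S, 0 < f x) :
    ConcaveOn ℝ S (fun x => Real.log (f x)) := by
  refine ⟨hf.1, fun x hx y hy a b ha hb hab => ?_⟩
  have hx' := Real.rpow_pos_of_pos (hpos x hx) p
  have hy' := Real.rpow_pos_of_pos (hpos y hy) p
  have h1 := strictConcaveOn_log_Ioi.concaveOn.2 hx' hy' ha hb hab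
  have h2 := Real.log_le_log (strictConcaveOn_log_Ioi.concaveOn.1 hx' hy' ha hb hab)
    (hf.2 hx hy ha hb hab)
  have h3 := h1.trans h2
  rw [Real.log_rpow (hpos x hx), Real.log_rpow (hpos y hy),
    Real.log_rpow (hpos _ (hf.1 hx hy ha hb hab))] at h3
  simp only [smul_eq_mul] at h3 ⊢
  refine le_of_mul_le_mul_left ?_ hp
  linarith

/-- Extend a vector by a coordinate equal to `1`. -/
def extendOne {n : ℕ} (lam : Fin n → ℝ) : Option (Fin n) → ℝ :=
  fun o => o.elim 1 lam

lemma extendOne_combo {n : ℕ} (x y : Fin n → ℝ) {a b : ℝ} (hab : a + b = 1) :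
    extendOne (a • x + b • y) = a • extendOne x + b • extendOne y := by
  ext o
  cases o <;> simp [extendOne, hab]

lemma univ_option_erase_none (n : ℕ) :
    (Finset.univ : Finset (Option (Fin n))).erase none =
      Finset.univ.map Function.Embedding.some := by
  ext o
  cases o <;> simp

lemma elemSymm_erase_none_extendOne {n : ℕ} (k : ℕ) (lam : Fin n → ℝ) :
    elemSymm (Finset.univ.erase none) k (extendOne lam) = esymm n k lam := by
  rw [univ_option_erase_none, elemSymm_map]
  rfl

lemma elemSymm_extendOne {n : ℕ} (k : ℕ) (lam : Fin n → ℝ) :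
    elemSymm Finset.univ (k + 1) (extendOne lam) = esymm n (k + 1) lam + esymm n k lam := by
  rw [elemSymm_erase (Finset.mem_univ none), elemSymm_erase_none_extendOne,
    elemSymm_erase_none_extendOne]
  simp [extendOne]

lemma esymm_zero (n : ℕ) (lam : Fin n → ℝ) : esymm n 0 lam = 1 := by
  simp [esymm]

lemma mem_GammaTilde_succ_iff {n k : ℕ} {lam : Fin n → ℝ} :
    lam ∈ GammaTilde n (k + 1) ↔ extendOne lam ∈ gardingCone Finset.univ (k + 1) := by
  have hcone : ∀ {k : ℕ}, lam ∈ GammaCone n k → ∀ i ≤ k, 0 < esymm n i lam := by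
    intro k h i hi
    rcases Nat.eq_zero_or_pos i with rfl | hi0
    · simp [esymm_zero]
    · exact h i hi0 hi
  constructor
  · rintro ⟨h1, h2⟩
    intro i hi
    cases i with
    | zero => simp
    | succ i =>
      rw [elemSymm_extendOne]
      rcases hi.eq_or_lt with h | h
      · rw [h, show i = k by omega]
        exact h2
      · exact add_pos (hcone h1 _ (by simp; omega)) (hcone h1 _ (by simp; omega))
  · intro h
    refine ⟨fun i _ hi => ?_, ?_⟩
    · rw [← elemSymm_erase_none_extendOne]
      exact mem_gardingCone_erase (Finset.mem_univ none) h i hi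
    · have := h (k + 1) le_rfl
      rwa [elemSymm_extendOne] at this

/-- `S_k^{1/k}` and `log S_k` are concave on the convex set `Γ̃_k`. -/
theorem Sk_pow_and_log_concave (n k : ℕ) (hk : 1 ≤ k) (hkn : k ≤ n) :
    ConcaveOn ℝ (GammaTilde n k)
      (fun lam => (esymm n k lam + esymm n (k - 1) lam) ^ ((1 : ℝ) / k)) ∧
    ConcaveOn ℝ (GammaTilde n k)
      (fun lam => Real.log (esymm n k lam + esymm n (k - 1) lam)) := by
  have hpow : ConcaveOn ℝ (GammaTilde n k)
      (fun lam => (esymm n k lam + esymm n (k - 1) lam) ^ ((1 : ℝ) / k)) := by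
    obtain ⟨k, rfl⟩ : ∃ m, k = m + 1 := ⟨k - 1, by omega⟩
    have h := concaveOn_elemSymm_rpow (Finset.univ : Finset (Option (Fin n))) hk
    refine ⟨fun x hx y hy a b ha hb hab => ?_, fun x hx y hy a b ha hb hab => ?_⟩
    · rw [mem_GammaTilde_succ_iff] at hx hy ⊢
      rw [extendOne_combo x y hab]
      exact h.1 hx hy ha hb hab
    · rw [mem_GammaTilde_succ_iff] at hx hy
      have := h.2 hx hy ha hb hab
      rw [← extendOne_combo x y hab] at this
      simpa only [elemSymm_extendOne, Nat.add_sub_cancel] using this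
  exact ⟨hpow, hpow.log_of_rpow (by positivity) fun x hx => hx.2⟩
end
end

section
/- Let 1 ≤ k ≤ n. There exists a constant c₂ > 0, depending only on n and k, such that for every λ ∈ Γ̃_k with λ₁ ≥ λ₂ ≥ ⋯ ≥ λ_n and every index j with k ≤ j ≤ n, one has ∂S_k/∂λ_j (λ) ≥ c₂ · Σ_{i=1}^{n} ∂S_k/∂λ_i (λ), where ∂S_k/∂λ_i (λ) = σ_{k-1}(λ|i) + σ_{k-2}(λ|i). -/
open scoped BigOperators
noncomputable section

/-- `σ_m(λ|i)`: the `m`-th elementary symmetric function of `λ` with the `i`-th entry deleted. -/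
def esymmErase (n k : ℕ) (lam : Fin n → ℝ) (i : Fin n) : ℝ :=
  ∑ s ∈ (Finset.univ.erase i).powersetCard k, ∏ j ∈ s, lam j

/-- `σ_m(λ|i)` for integer index `m`, with the convention `σ_m = 0` for `m < 0`. -/
def esymmEraseZ (n : ℕ) (k : ℤ) (lam : Fin n → ℝ) (i : Fin n) : ℝ :=
  if 0 ≤ k then esymmErase n k.toNat lam i else 0

open Polynomial in
/-- A real polynomial with only real roots satisfies the Laguerre inequality `f f'' ≤ f'²`. -/
theorem Polynomial.Splits.eval_mul_eval_derivative_derivative_le {f : ℝ[X]} (hf : f.Splits)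
    (x : ℝ) :
    f.eval x * (derivative (derivative f)).eval x ≤ (derivative f).eval x ^ 2 := by
  induction hf using Submonoid.closure_induction with
  | mem f hf =>
    rcases hf with ⟨a, rfl⟩ | ⟨a, rfl⟩ <;> simp
  | one => simp
  | mul f g _ _ hf hg =>
    simp only [derivative_mul, derivative_add, eval_add, eval_mul]
    nlinarith [mul_le_mul_of_nonneg_left hf (sq_nonneg (g.eval x)),
      mul_le_mul_of_nonneg_left hg (sq_nonneg (f.eval x))]

open Polynomial in
/-- By Rolle's theorem, the derivative of a real polynomial with only real roots has only real
roots. -/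
theorem Polynomial.Splits.derivative_real_s10 {f : ℝ[X]} (hf : f.Splits) : (derivative f).Splits := by
  rw [splits_iff_card_roots] at hf ⊢
  have h := card_roots_le_derivative f
  have h' := card_roots' (derivative f)
  have h'' := natDegree_derivative_le f
  by_cases h0 : f.natDegree = 0
  · rw [natDegree_eq_zero] at h0
    obtain ⟨c, rfl⟩ := h0
    simp
  · omega

open Polynomial in
theorem Polynomial.Splits.iterate_derivative_real_s10 {f : ℝ[X]} (hf : f.Splits) (j : ℕ) :
    (derivative^[j] f).Splits := by
  induction j with
  | zero => exact hf
  | succ j ih => rw [Function.iterate_succ_apply']; exact ih.derivative_real_s10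

open Polynomial in
theorem Polynomial.Splits.coeff_mul_coeff_le {f : ℝ[X]} (hf : f.Splits) (j : ℕ) :
    (j + 2 : ℝ) * (f.coeff j * f.coeff (j + 2)) ≤ (j + 1) * f.coeff (j + 1) ^ 2 := by
  have h := (hf.iterate_derivative_real_s10 j).eval_mul_eval_derivative_derivative_le 0
  have key : ∀ i, (derivative^[i] f).eval 0 = i.factorial * f.coeff i := by
    intro i
    rw [← coeff_zero_eq_eval_zero, coeff_iterate_derivative, zero_add, Nat.descFactorial_self,
      nsmul_eq_mul]
  rw [← Function.iterate_succ_apply' derivative, ← Function.iterate_succ_apply' derivative,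
    key, key, key, Nat.factorial_succ (j + 1), Nat.factorial_succ j] at h
  have hpos : (0 : ℝ) < (j.factorial : ℝ) ^ 2 * (j + 1) := by positivity
  push_cast at h
  refine le_of_mul_le_mul_left ?_ hpos
  linarith

namespace Multiset

theorem esymm_zero_right {R : Type*} [CommSemiring R] (s : Multiset R) : s.esymm 0 = 1 := by
  simp [esymm]

theorem esymm_one_right {R : Type*} [CommSemiring R] (s : Multiset R) : s.esymm 1 = s.sum := by
  simp [esymm, powersetCard_one]

theorem esymm_cons_succ {R : Type*} [CommSemiring R] (a : R) (s : Multiset R) (k : ℕ) :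
    (a ::ₘ s).esymm (k + 1) = s.esymm (k + 1) + a * s.esymm k := by
  simp [esymm, powersetCard_cons, sum_map_mul_left]

theorem esymm_of_card_lt {R : Type*} [CommSemiring R] {s : Multiset R} {k : ℕ} (h : card s < k) :
    s.esymm k = 0 := by
  simp [esymm, powersetCard_eq_empty k h]

/-- Newton's inequality for elementary symmetric functions, with a non-optimal constant. -/
theorem card_succ_mul_esymm_mul_esymm_le (s : Multiset ℝ) (m : ℕ) :
    (card s + 1 : ℝ) * (s.esymm m * s.esymm (m + 2)) ≤ card s * s.esymm (m + 1) ^ 2 := by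
  by_cases hm : m + 2 ≤ card s
  · obtain ⟨j, hj⟩ := Nat.exists_eq_add_of_le hm
    have hs : (s.map fun r => Polynomial.X + Polynomial.C r).prod.Splits := by
      refine Polynomial.Splits.multisetProd fun f hf => ?_
      obtain ⟨r, -, rfl⟩ := mem_map.1 hf
      exact Polynomial.Splits.X_add_C r
    have h := hs.coeff_mul_coeff_le j
    rw [prod_X_add_C_coeff s (by omega), prod_X_add_C_coeff s (by omega),
      prod_X_add_C_coeff s (by omega), show card s - j = m + 2 by omega,
      show card s - (j + 2) = m by omega, show card s - (j + 1) = m + 1 by omega] at h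
    have hc : (card s : ℝ) = m + 2 + j := by rw [hj]; push_cast; ring
    have h2 : (0 : ℝ) < j + 2 := by positivity
    refine le_of_mul_le_mul_left ?_ h2
    have hn : (0 : ℝ) ≤ card s + 1 := by positivity
    have := mul_le_mul_of_nonneg_left h hn
    have hm0 : (0 : ℝ) ≤ m + 1 := by positivity
    have := mul_nonneg hm0 (sq_nonneg (s.esymm (m + 1)))
    rw [hc] at *
    linarith
  · rw [esymm_of_card_lt (s := s) (k := m + 2) (by omega)]
    simp only [mul_zero]
    positivity

theorem esymm_mul_esymm_le (s : Multiset ℝ) (m : ℕ) :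
    s.esymm m * s.esymm (m + 2) ≤ s.esymm (m + 1) ^ 2 := by
  have h := card_succ_mul_esymm_mul_esymm_le s m
  have hc : (0 : ℝ) < card s + 1 := by positivity
  refine le_of_mul_le_mul_left ?_ hc
  nlinarith [sq_nonneg (s.esymm (m + 1))]

/-- The Gårding cone `Γ_k`, as a set of multisets of reals. -/
def gardingCone (k : ℕ) : Set (Multiset ℝ) := {s | ∀ i ≤ k, 0 < s.esymm i}

theorem gardingCone_anti : Antitone gardingCone :=
  fun _ _ h _ hs i hi => hs i (hi.trans h)

/-- Deleting an entry maps `Γ_{k+1}` into `Γ_k`. -/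
theorem mem_gardingCone_of_cons {k : ℕ} {t : ℝ} {s : Multiset ℝ}
    (h : t ::ₘ s ∈ gardingCone (k + 1)) : s ∈ gardingCone k := by
  induction k with
  | zero =>
    intro i hi
    obtain rfl : i = 0 := by omega
    simp [esymm_zero_right]
  | succ k ih =>
    have hs := ih (gardingCone_anti (Nat.le_succ _) h)
    intro i hi
    rcases Nat.le_succ_iff.1 hi with hi | rfl
    · exact hs i hi
    have h0 := hs k le_rfl
    have h1 := h (k + 1) (by omega)
    have h2 := h (k + 2) le_rfl
    rw [esymm_cons_succ] at h1 h2
    have hN := esymm_mul_esymm_le s k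
    by_contra! hneg
    have ht : 0 < t := pos_of_mul_pos_left (b := s.esymm k) (by linarith) h0.le
    change s.esymm (k + 1) ≤ 0 at hneg
    nlinarith [mul_pos h0 h2, mul_nonneg (neg_nonneg.2 hneg) h1.le]

theorem esymm_succ_le_sum_mul {k : ℕ} {s : Multiset ℝ} (h : s ∈ gardingCone k) :
    s.esymm (k + 1) ≤ s.sum * s.esymm k := by
  induction k with
  | zero => simp [esymm_zero_right, esymm_one_right]
  | succ k ih =>
    have h0 := h k (by omega)
    have h1 := h (k + 1) le_rfl
    have ih := ih (gardingCone_anti (Nat.le_succ _) h)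
    have hN := esymm_mul_esymm_le s k
    refine le_of_mul_le_mul_left ?_ h0
    nlinarith [mul_le_mul_of_nonneg_right ih h1.le]

/-- Deleting one of two entries `b ≤ a` of a point of `Γ_{k+2}`: the expansion of
`σ_{k+1}` along the larger entry `a` does not degenerate. -/
theorem mul_esymm_le_esymm_cons {k : ℕ} {a b : ℝ} {s : Multiset ℝ} (hab : b ≤ a)
    (h : b ::ₘ a ::ₘ s ∈ gardingCone (k + 2)) :
    a * s.esymm k ≤ 2 * (card s + 1) * (a ::ₘ s).esymm (k + 1) := by
  have ha := mem_gardingCone_of_cons h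
  have hb := mem_gardingCone_of_cons (cons_swap b a s ▸ h)
  have hp := mem_gardingCone_of_cons ha k le_rfl
  have h2 := h (k + 2) le_rfl
  have ha1 := ha (k + 1) le_rfl
  have hb1 := hb (k + 1) le_rfl
  have hN := card_succ_mul_esymm_mul_esymm_le s k
  rw [esymm_cons_succ] at ha1 hb1 ⊢
  rw [esymm_cons_succ, esymm_cons_succ, esymm_cons_succ] at h2
  set p := s.esymm k
  set q := s.esymm (k + 1)
  set r := s.esymm (k + 2)
  have hc : (0 : ℝ) ≤ (card s : ℝ) := by positivity
  set N : ℝ := (card s : ℝ)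
  by_cases hx : 0 ≤ a * p + 2 * q
  · nlinarith
  push Not at hx
  have hbp : b * p ≤ a * p := mul_le_mul_of_nonneg_right hab hp.le
  have hap : 0 < a * p := by linarith
  have hprod : q ^ 2 ≤ (N + 1) * ((a * p + q) * (b * p + q)) := by
    have := mul_pos hp h2
    nlinarith
  have hle : (a * p + q) * (b * p + q) ≤ (a * p + q) * (a * p / 2) :=
    mul_le_mul_of_nonneg_left (by linarith) (by linarith)
  have hq : (a * p) ^ 2 / 4 ≤ q ^ 2 := by nlinarith
  refine le_of_mul_le_mul_left ?_ hap
  nlinarith [mul_le_mul_of_nonneg_left hle (by linarith : 0 ≤ N + 1)]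

/-- In `Γ_{k+1}`, deleting an entry which is dominated by at least `k` others does not decrease
`σ_k` by more than a constant factor. -/
theorem exists_mul_esymm_cons_le (k N : ℕ) :
    ∃ c : ℝ, 0 < c ∧ ∀ (s : Multiset ℝ) (b : ℝ), card s = N →
      b ::ₘ s ∈ gardingCone (k + 1) → k ≤ card (s.filter (b ≤ ·)) →
        c * (b ::ₘ s).esymm k ≤ s.esymm k := by
  induction k generalizing N with
  | zero => exact ⟨1, one_pos, fun s b _ _ _ => by simp [esymm_zero_right]⟩
  | succ k ih =>
    obtain ⟨c, hc, ih⟩ := ih (N - 1)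
    refine ⟨c / (2 * N * (N + 1) + 1), by positivity, fun s b hs hΓ hcard => ?_⟩
    obtain ⟨d, hd⟩ := card_pos_iff_exists_mem.1 (lt_of_lt_of_le k.succ_pos hcard)
    rw [mem_filter] at hd
    obtain ⟨a, has, hmax⟩ := s.toFinset.exists_max_image id ⟨d, mem_toFinset.2 hd.1⟩
    simp only [mem_toFinset, id] at has hmax
    obtain ⟨s, rfl⟩ := exists_cons_of_mem has
    have hba : b ≤ a := hd.2.trans (hmax d hd.1)
    rw [card_cons] at hs
    have hΓb : b ::ₘ s ∈ gardingCone (k + 1) :=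
      mem_gardingCone_of_cons (cons_swap b a s ▸ hΓ)
    have hfilter : k ≤ card (s.filter (b ≤ ·)) := by
      rw [filter_cons_of_pos _ hba, card_cons] at hcard
      exact Nat.le_of_succ_le_succ hcard
    have hih := ih s b (by omega) hΓb hfilter
    have hdrop := mul_esymm_le_esymm_cons hba hΓ
    have hsum : (b ::ₘ s).sum ≤ N * a := by
      have := sum_le_card_nsmul (b ::ₘ s) a (by
        intro x hx
        rcases mem_cons.1 hx with rfl | hx
        · exact hba
        · exact hmax x (mem_cons_of_mem hx))
      rwa [card_cons, hs, nsmul_eq_mul] at this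
    have hpos := hΓb k (by omega)
    have hNs : (N : ℝ) = card s + 1 := by rw [← hs]; push_cast; ring
    have ha : 0 < a := by
      have h1 := hΓ 1 (by omega)
      rw [esymm_one_right, cons_swap, sum_cons] at h1
      have : 0 < (N + 1) * a := by linarith
      exact pos_of_mul_pos_right this (by positivity)
    have hup : (b ::ₘ a ::ₘ s).esymm (k + 1) ≤ (N + 1) * (a * (b ::ₘ s).esymm k) := by
      rw [cons_swap, esymm_cons_succ]
      have := esymm_succ_le_sum_mul (gardingCone_anti (Nat.le_succ k) hΓb)
      nlinarith [mul_le_mul_of_nonneg_right hsum hpos.le]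
    have hT := (mem_gardingCone_of_cons hΓ) (k + 1) le_rfl
    rw [← hNs] at hdrop
    rw [div_mul_eq_mul_div, div_le_iff₀ (by positivity)]
    calc c * (b ::ₘ a ::ₘ s).esymm (k + 1)
        ≤ c * ((N + 1) * (a * (b ::ₘ s).esymm k)) := by gcongr
      _ = (N + 1) * a * (c * (b ::ₘ s).esymm k) := by ring
      _ ≤ (N + 1) * a * s.esymm k := by gcongr
      _ = (N + 1) * (a * s.esymm k) := by ring
      _ ≤ (N + 1) * (2 * N * (a ::ₘ s).esymm (k + 1)) := by gcongr
      _ ≤ (a ::ₘ s).esymm (k + 1) * (2 * N * (N + 1) + 1) := by linarith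

end Multiset

theorem esymm_eq_multiset_esymm (n k : ℕ) (lam : Fin n → ℝ) :
    esymm n k lam = ((Finset.univ : Finset (Fin n)).val.map lam).esymm k :=
  (Finset.esymm_map_val lam Finset.univ k).symm

theorem esymmErase_eq_multiset_esymm (n k : ℕ) (lam : Fin n → ℝ) (i : Fin n) :
    esymmErase n k lam i = ((Finset.univ.erase i).val.map lam).esymm k :=
  (Finset.esymm_map_val lam (Finset.univ.erase i) k).symm

theorem sum_esymmErase (n m : ℕ) (lam : Fin n → ℝ) :
    ∑ i, esymmErase n m lam i = ((n - m : ℕ) : ℝ) * esymm n m lam := by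
  unfold esymmErase esymm
  rw [Finset.sum_comm' (s' := fun s => sᶜ) (t' := Finset.univ.powersetCard m), Finset.mul_sum]
  · refine Finset.sum_congr rfl fun s hs => ?_
    rw [Finset.sum_const, Finset.card_compl, (Finset.mem_powersetCard.1 hs).2, Fintype.card_fin,
      nsmul_eq_mul]
  · intro i s
    simp [Finset.mem_powersetCard, Finset.subset_erase]

theorem sum_esymmErase_le {n m : ℕ} {lam : Fin n → ℝ} (h : 0 ≤ esymm n m lam) :
    ∑ i, esymmErase n m lam i ≤ n * esymm n m lam := by
  rw [sum_esymmErase]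
  gcongr
  exact Nat.sub_le n m

theorem one_cons_mem_gardingCone {n k : ℕ} {lam : Fin n → ℝ}
    (h : lam ∈ GammaTilde n (k + 1)) :
    1 ::ₘ (Finset.univ : Finset (Fin n)).val.map lam ∈ Multiset.gardingCone (k + 1) := by
  obtain ⟨hΓ, hS⟩ := h
  have hpos : ∀ i ≤ k, 0 < ((Finset.univ : Finset (Fin n)).val.map lam).esymm i := by
    intro i hi
    rcases Nat.eq_zero_or_pos i with rfl | hi0
    · simp [Multiset.esymm_zero_right]
    · rw [← esymm_eq_multiset_esymm]
      exact hΓ i hi0 (by omega)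
  intro i hi
  cases i with
  | zero => simp [Multiset.esymm_zero_right]
  | succ i =>
    rw [Multiset.esymm_cons_succ, one_mul]
    rcases Nat.lt_or_ge i k with hik | hik
    · exact add_pos (hpos _ hik) (hpos _ hik.le)
    · obtain rfl : i = k := by omega
      simpa [esymm_eq_multiset_esymm] using hS

theorem le_card_filter_erase {n : ℕ} {lam : Fin n → ℝ} (hlam : Antitone lam) (j : Fin n) :
    (j : ℕ) ≤ (((Finset.univ.erase j).val.map lam).filter (lam j ≤ ·)).card := by
  rw [Multiset.filter_map, Multiset.card_map]
  change (j : ℕ) ≤ ((Finset.univ.erase j).filter fun i => lam j ≤ lam i).card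
  rw [← Fin.card_Iio j]
  refine Finset.card_le_card fun i hi => ?_
  rw [Finset.mem_Iio] at hi
  simp [hi.ne, hlam hi.le]

/-- For `λ ∈ Γ̃_k` ordered decreasingly and any index `j ≥ k` (one-indexed, i.e. the Fin index
`j` satisfies `k ≤ j+1`), one has `∂S_k/∂λ_j ≥ c₂ Σ_i ∂S_k/∂λ_i`. -/
theorem Sk_derivative_lower_bound_large_index (n k : ℕ) (hk : 1 ≤ k) (hkn : k ≤ n) :
    ∃ c₂ : ℝ, 0 < c₂ ∧
      ∀ lam ∈ GammaTilde n k, Antitone lam →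
        ∀ j : Fin n, k ≤ (j : ℕ) + 1 →
          c₂ * ∑ i : Fin n,
              (esymmEraseZ n ((k : ℤ) - 1) lam i + esymmEraseZ n ((k : ℤ) - 2) lam i) ≤
            esymmEraseZ n ((k : ℤ) - 1) lam j + esymmEraseZ n ((k : ℤ) - 2) lam j := by
  obtain ⟨k, rfl⟩ := Nat.exists_eq_add_of_le' hk
  obtain ⟨c, hc, h⟩ := Multiset.exists_mul_esymm_cons_le k n
  refine ⟨c / (n + 1), by positivity, fun lam hlam hanti j hj => ?_⟩
  have hΓ := one_cons_mem_gardingCone hlam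
  have hsplit : (Finset.univ : Finset (Fin n)).val.map lam =
      lam j ::ₘ (Finset.univ.erase j).val.map lam := by
    rw [← Multiset.map_cons, Finset.erase_val, Multiset.cons_erase (Finset.mem_univ_val j)]
  have hcard : Multiset.card (1 ::ₘ (Finset.univ.erase j).val.map lam) = n := by
    have := congrArg Multiset.card hsplit
    simpa using this.symm
  have hfilter : k ≤ Multiset.card
      ((1 ::ₘ (Finset.univ.erase j).val.map lam).filter (lam j ≤ ·)) :=
    calc k ≤ (j : ℕ) := by omega
      _ ≤ _ := le_card_filter_erase hanti j
      _ ≤ _ := Multiset.card_le_card (Multiset.filter_le_filter _ (Multiset.le_cons_self _ _))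
  have key := h _ (lam j) hcard (by rwa [Multiset.cons_swap, ← hsplit]) hfilter
  rw [Multiset.cons_swap, ← hsplit] at key
  have hΓ' := Multiset.mem_gardingCone_of_cons hΓ
  rw [div_mul_eq_mul_div, div_le_iff₀ (by positivity)]
  cases k with
  | zero =>
    simp only [Multiset.esymm_zero_right] at key
    simp [esymmEraseZ, esymmErase]
    nlinarith
  | succ k =>
    have e1 : ((k + 1 + 1 : ℕ) : ℤ) - 1 = ((k + 1 : ℕ) : ℤ) := by push_cast; ring
    have e2 : ((k + 1 + 1 : ℕ) : ℤ) - 2 = ((k : ℕ) : ℤ) := by push_cast; ring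
    simp only [e1, e2, esymmEraseZ, Int.natCast_nonneg, if_true, Int.toNat_natCast,
      Finset.sum_add_distrib]
    have h1 := (hΓ' (k + 1) le_rfl).le
    have h0 := (hΓ' k (by omega)).le
    rw [Multiset.esymm_cons_succ, Multiset.esymm_cons_succ, one_mul, one_mul,
      ← esymmErase_eq_multiset_esymm, ← esymmErase_eq_multiset_esymm] at key
    rw [← esymm_eq_multiset_esymm] at h0 h1
    rw [← esymm_eq_multiset_esymm, ← esymm_eq_multiset_esymm] at key
    have s1 := sum_esymmErase_le h1
    have s0 := sum_esymmErase_le h0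
    calc c * (∑ i, esymmErase n (k + 1) lam i + ∑ i, esymmErase n k lam i)
        ≤ c * (n * esymm n (k + 1) lam + n * esymm n k lam) := by gcongr
      _ ≤ c * (esymm n (k + 1) lam + esymm n k lam) * (n + 1) := by
        nlinarith [mul_nonneg hc.le h1, mul_nonneg hc.le h0]
      _ ≤ _ := by gcongr
end
end

section
/- Let n ≥ 3, let a = (3/(n(n-1)(n-2)))^{1/3} and C₀ = ((n-1)(n-2)/2)·a² (equivalently C₀ = (9(n-1)(n-2)/(8n²))^{1/3}). Then for every μ ∈ ℝⁿ, denoting by 𝟙 = (1,…,1) ∈ ℝⁿ: σ₃(μ + a·𝟙) - C₀·σ₁(μ + a·𝟙) = σ₃(μ) + (n-2)a·σ₂(μ) - 1. In particular, if u solves σ₃(D²u) = C₀·σ₁(D²u), then v = u - (a/2)|x|² solves σ₃(D²v) + (n-2)a·σ₂(D²v) = 1. -/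
open scoped BigOperators
noncomputable section

open Finset in
/-- Recursion for the elementary symmetric functions on adjoining one variable. -/
lemma sum_powersetCard_succ_insert_prod {ι R : Type*} [DecidableEq ι] [CommSemiring R]
    {s : Finset ι} {x : ι} (hx : x ∉ s) (k : ℕ) (f : ι → R) :
    ∑ t ∈ (insert x s).powersetCard (k + 1), ∏ i ∈ t, f i =
      ∑ t ∈ s.powersetCard (k + 1), ∏ i ∈ t, f i +
        f x * ∑ t ∈ s.powersetCard k, ∏ i ∈ t, f i := by
  have hmem : ∀ t ∈ s.powersetCard k, x ∉ t := fun t ht h =>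
    hx ((mem_powersetCard.1 ht).1 h)
  rw [powersetCard_succ_insert hx, sum_union, sum_image, mul_sum]
  · exact congrArg _ (sum_congr rfl fun t ht => prod_insert (hmem t ht))
  · intro t ht u hu h
    rw [← erase_insert (hmem t ht), h, erase_insert (hmem u hu)]
  · refine disjoint_left.2 fun t ht ht' => ?_
    obtain ⟨u, -, rfl⟩ := mem_image.1 ht'
    exact hx ((mem_powersetCard.1 ht).1 (mem_insert_self x u))

open Finset in
/-- The second elementary symmetric function of variables shifted by a constant. -/
lemma sum_powersetCard_two_prod_add_const {ι : Type*} (s : Finset ι) (f : ι → ℝ) (a : ℝ) :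
    ∑ t ∈ s.powersetCard 2, ∏ i ∈ t, (f i + a) =
      ∑ t ∈ s.powersetCard 2, ∏ i ∈ t, f i + ((#s : ℝ) - 1) * a * ∑ i ∈ s, f i +
        (#s : ℝ) * ((#s : ℝ) - 1) / 2 * a ^ 2 := by
  classical
  induction s using Finset.induction_on with
  | empty => simp [powersetCard_eq_empty.2 (show #(∅ : Finset ι) < 2 by simp)]
  | insert x s hx ih =>
    simp only [sum_powersetCard_succ_insert_prod hx 1, ih, card_insert_of_notMem hx,
      sum_insert hx, powersetCard_one, sum_map, Function.Embedding.coeFn_mk, prod_singleton,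
      sum_add_distrib, sum_const, nsmul_eq_mul]
    push_cast
    ring

open Finset in
/-- The third elementary symmetric function of variables shifted by a constant. -/
lemma sum_powersetCard_three_prod_add_const {ι : Type*} (s : Finset ι) (f : ι → ℝ) (a : ℝ) :
    ∑ t ∈ s.powersetCard 3, ∏ i ∈ t, (f i + a) =
      ∑ t ∈ s.powersetCard 3, ∏ i ∈ t, f i +
        ((#s : ℝ) - 2) * a * ∑ t ∈ s.powersetCard 2, ∏ i ∈ t, f i +
        ((#s : ℝ) - 1) * ((#s : ℝ) - 2) / 2 * a ^ 2 * ∑ i ∈ s, f i +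
        (#s : ℝ) * ((#s : ℝ) - 1) * ((#s : ℝ) - 2) / 6 * a ^ 3 := by
  classical
  induction s using Finset.induction_on with
  | empty =>
    simp [powersetCard_eq_empty.2 (show #(∅ : Finset ι) < 2 by simp),
      powersetCard_eq_empty.2 (show #(∅ : Finset ι) < 3 by simp)]
  | insert x s hx ih =>
    simp only [sum_powersetCard_succ_insert_prod hx 2, sum_powersetCard_succ_insert_prod hx 1,
      ih, sum_powersetCard_two_prod_add_const, card_insert_of_notMem hx, sum_insert hx,
      powersetCard_one, sum_map, Function.Embedding.coeFn_mk, prod_singleton]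
    push_cast
    ring

lemma esymm_one (n : ℕ) (μ : Fin n → ℝ) : esymm n 1 μ = ∑ i, μ i := by
  simp [esymm, Finset.powersetCard_one]

/-- With `a = (3/(n(n-1)(n-2)))^{1/3}` and `C₀ = ((n-1)(n-2)/2)a²`, one has the identity
`σ₃(μ + a𝟙) - C₀σ₁(μ + a𝟙) = σ₃(μ) + (n-2)a σ₂(μ) - 1` for every `μ ∈ ℝⁿ`. -/
theorem shift_identity_quotient_l_eq_one
    (n : ℕ) (hn : 3 ≤ n) (a C₀ : ℝ)
    (ha : a = (3 / ((n : ℝ) * ((n : ℝ) - 1) * ((n : ℝ) - 2))) ^ ((1 : ℝ) / 3))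
    (hC₀ : C₀ = (((n : ℝ) - 1) * ((n : ℝ) - 2) / 2) * a ^ 2) :
    ∀ μ : Fin n → ℝ,
      esymm n 3 (fun i => μ i + a) - C₀ * esymm n 1 (fun i => μ i + a) =
        esymm n 3 μ + ((n : ℝ) - 2) * a * esymm n 2 μ - 1 := by
  intro μ
  have hn' : (3 : ℝ) ≤ n := by exact_mod_cast hn
  have hpos : 0 < (n : ℝ) * ((n : ℝ) - 1) * ((n : ℝ) - 2) :=
    mul_pos (mul_pos (by linarith) (by linarith)) (by linarith)
  have ha3 : (n : ℝ) * ((n : ℝ) - 1) * ((n : ℝ) - 2) * a ^ 3 = 3 := by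
    rw [ha, ← Real.rpow_natCast, ← Real.rpow_mul (by positivity)]
    norm_num
    exact mul_div_cancel₀ _ hpos.ne'
  have h₃ : esymm n 3 (fun i => μ i + a) =
      esymm n 3 μ + ((n : ℝ) - 2) * a * esymm n 2 μ +
        ((n : ℝ) - 1) * ((n : ℝ) - 2) / 2 * a ^ 2 * ∑ i, μ i +
        (n : ℝ) * ((n : ℝ) - 1) * ((n : ℝ) - 2) / 6 * a ^ 3 := by
    simpa only [esymm, Finset.card_univ, Fintype.card_fin] using
      sum_powersetCard_three_prod_add_const Finset.univ μ a
  rw [h₃, hC₀, esymm_one, Finset.sum_add_distrib, Finset.sum_const, Finset.card_univ,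
    Fintype.card_fin, nsmul_eq_mul]
  linear_combination (-1 / 3 : ℝ) * ha3
end
end

section
/- Let n ≥ 3, let a = (3/(n(n-1)(n-2)))^{1/3} and C₀ = ((n-1)(n-2)/2)·a². Let λ ∈ Γ₃ satisfy σ₃(λ) = C₀·σ₁(λ), and set μ = λ - a·𝟙 (i.e. μ_i = λ_i - a for each i). Then σ₁(μ) > 0 and σ₂(μ) + (n-2)a·σ₁(μ) > 0. -/
open scoped BigOperators
noncomputable section

theorem sum_powersetCard_succ_insert {ι : Type*} [DecidableEq ι] (f : ι → ℝ) {t : Finset ι}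
    {j : ι} (hj : j ∉ t) (k : ℕ) :
    ∑ s ∈ (insert j t).powersetCard (k + 1), ∏ i ∈ s, f i =
      ∑ s ∈ t.powersetCard (k + 1), ∏ i ∈ s, f i
        + f j * ∑ s ∈ t.powersetCard k, ∏ i ∈ s, f i := by
  have hmem : ∀ s ∈ t.powersetCard k, j ∉ s := fun s hs h =>
    hj ((Finset.mem_powersetCard.1 hs).1 h)
  have hdisj : Disjoint (t.powersetCard (k + 1)) ((t.powersetCard k).image (insert j)) := by
    refine Finset.disjoint_left.2 fun s hs hs' => ?_
    obtain ⟨r, -, rfl⟩ := Finset.mem_image.1 hs'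
    exact hj ((Finset.mem_powersetCard.1 hs).1 (Finset.mem_insert_self j r))
  rw [Finset.powersetCard_succ_insert hj, Finset.sum_union hdisj, Finset.sum_image, Finset.mul_sum]
  · congr 1
    exact Finset.sum_congr rfl fun s hs => Finset.prod_insert (hmem s hs)
  · intro s hs r hr h
    rw [← Finset.erase_insert (hmem s hs), ← Finset.erase_insert (hmem r hr)]
    exact congrArg (fun u => Finset.erase u j) h

theorem sum_powersetCard_one {ι : Type*} (f : ι → ℝ) (t : Finset ι) :
    ∑ s ∈ t.powersetCard 1, ∏ i ∈ s, f i = ∑ i ∈ t, f i := by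
  simp [Finset.powersetCard_one]

theorem sum_powersetCard_two {ι : Type*} [DecidableEq ι] (f : ι → ℝ) (t : Finset ι) :
    2 * ∑ s ∈ t.powersetCard 2, ∏ i ∈ s, f i = (∑ i ∈ t, f i) ^ 2 - ∑ i ∈ t, f i ^ 2 := by
  induction t using Finset.induction_on with
  | empty => simp [Finset.powersetCard_eq_empty.2 (Finset.card_empty.trans_lt (Nat.succ_pos _))]
  | insert j t hj ih =>
    rw [sum_powersetCard_succ_insert f hj, sum_powersetCard_one, Finset.sum_insert hj,
      Finset.sum_insert hj]
    linear_combination ih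

theorem sum_powersetCard_three {ι : Type*} [DecidableEq ι] (f : ι → ℝ) (t : Finset ι) :
    6 * ∑ s ∈ t.powersetCard 3, ∏ i ∈ s, f i =
      (∑ i ∈ t, f i) ^ 3 - 3 * (∑ i ∈ t, f i) * ∑ i ∈ t, f i ^ 2 + 2 * ∑ i ∈ t, f i ^ 3 := by
  induction t using Finset.induction_on with
  | empty => simp [Finset.powersetCard_eq_empty.2 (Finset.card_empty.trans_lt (Nat.succ_pos _))]
  | insert j t hj ih =>
    rw [sum_powersetCard_succ_insert f hj, Finset.sum_insert hj, Finset.sum_insert hj,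
      Finset.sum_insert hj]
    linear_combination ih + 3 * f j * sum_powersetCard_two f t

/-- The Okumura inequality: an upper bound for the sum of cubes of numbers with zero sum. -/
theorem sum_cube_le_of_sum_eq_zero {n : ℕ} (hn : 1 ≤ n) (x : Fin n → ℝ) (k : ℝ) (hk : 0 ≤ k)
    (hx : ∑ i, x i = 0) (hx2 : ∑ i, x i ^ 2 = n * (n - 1) * k ^ 2) :
    ∑ i, x i ^ 3 ≤ n * (n - 1) * (n - 2) * k ^ 3 := by
  have hn' : (1 : ℝ) ≤ n := by exact_mod_cast hn
  have hbound : ∀ i, x i ≤ (n - 1) * k := by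
    intro i
    have hcs := sq_sum_le_card_mul_sum_sq (s := Finset.univ.erase i) (f := x)
    have h1 := Finset.add_sum_erase Finset.univ x (Finset.mem_univ i)
    have h2 := Finset.add_sum_erase Finset.univ (fun j => x j ^ 2) (Finset.mem_univ i)
    have hcard : ((Finset.univ.erase i).card : ℝ) = n - 1 := by
      rw [Finset.card_erase_of_mem (Finset.mem_univ i), Finset.card_univ, Fintype.card_fin,
        Nat.cast_sub hn, Nat.cast_one]
    rw [hx] at h1
    rw [hcard, eq_neg_of_add_eq_zero_right h1, eq_sub_of_add_eq' h2, hx2] at hcs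
    refine abs_le_of_sq_le_sq' ?_ (by nlinarith) |>.2
    have h3 : (n : ℝ) * x i ^ 2 ≤ n * ((n - 1) * k) ^ 2 := by linear_combination hcs
    exact le_of_mul_le_mul_left h3 (by linarith)
  have hnonneg : 0 ≤ ∑ i, ((n - 1) * k - x i) * (x i + k) ^ 2 :=
    Finset.sum_nonneg fun i _ => mul_nonneg (sub_nonneg.2 (hbound i)) (sq_nonneg _)
  have hexp : ∑ i, ((n - 1) * k - x i) * (x i + k) ^ 2 =
      -∑ i, x i ^ 3 + (n - 3) * k * ∑ i, x i ^ 2 + (2 * n - 3) * k ^ 2 * ∑ i, x i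
        + n * ((n - 1) * k ^ 3) := by
    have hc : (n : ℝ) * ((n - 1) * k ^ 3) = ∑ _i : Fin n, ((n - 1) * k ^ 3 : ℝ) := by simp
    rw [hc, Finset.mul_sum, Finset.mul_sum, ← Finset.sum_neg_distrib, ← Finset.sum_add_distrib,
      ← Finset.sum_add_distrib, ← Finset.sum_add_distrib]
    exact Finset.sum_congr rfl fun i _ => by ring
  rw [hexp, hx, hx2] at hnonneg
  linear_combination hnonneg

/-- The first three normalized elementary symmetric functions are `m`, `m ^ 2 - k ^ 2` and at most
`(m - k) ^ 2 * (m + 2 * k)`, where `m` is the mean and `k` the rescaled standard deviation. -/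
theorem exists_esymm_eq_and_le {n : ℕ} (hn : 3 ≤ n) (lam : Fin n → ℝ) :
    ∃ m k : ℝ, 0 ≤ k ∧ esymm n 1 lam = n * m ∧
      esymm n 2 lam = n * (n - 1) / 2 * (m ^ 2 - k ^ 2) ∧
      esymm n 3 lam ≤ n * (n - 1) * (n - 2) / 6 * ((m - k) ^ 2 * (m + 2 * k)) := by
  have hn' : (3 : ℝ) ≤ n := by exact_mod_cast hn
  have hn0 : (n : ℝ) ≠ 0 := by linarith
  have hn1 : (n : ℝ) - 1 ≠ 0 := by linarith
  obtain ⟨m, hm⟩ : ∃ m : ℝ, ∑ i, lam i = n * m := ⟨(∑ i, lam i) / n, by field_simp⟩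
  have hx : ∑ i, (lam i - m) = 0 := by simp [Finset.sum_sub_distrib, hm]
  obtain ⟨k, hk, hx2⟩ : ∃ k : ℝ, 0 ≤ k ∧ ∑ i, (lam i - m) ^ 2 = n * (n - 1) * k ^ 2 := by
    refine ⟨√((∑ i, (lam i - m) ^ 2) / (n * (n - 1))), Real.sqrt_nonneg _, ?_⟩
    rw [Real.sq_sqrt]
    · field_simp
    · exact div_nonneg (Finset.sum_nonneg fun i _ => sq_nonneg _)
        (mul_nonneg (by linarith) (by linarith))
  have hcube := sum_cube_le_of_sum_eq_zero (by lia) (fun i => lam i - m) k hk hx hx2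
  have hP2 : ∑ i, lam i ^ 2 = n * (n - 1) * k ^ 2 + n * m ^ 2 := by
    have hc : (n : ℝ) * m ^ 2 = ∑ _i : Fin n, m ^ 2 := by simp
    have h : ∑ i, lam i ^ 2 = ∑ i, (lam i - m) ^ 2 + 2 * m * ∑ i, (lam i - m) + n * m ^ 2 := by
      rw [hc, Finset.mul_sum, ← Finset.sum_add_distrib, ← Finset.sum_add_distrib]
      exact Finset.sum_congr rfl fun i _ => by ring
    rw [h, hx, hx2]
    ring
  have hP3 : ∑ i, lam i ^ 3 =
      ∑ i, (lam i - m) ^ 3 + 3 * m * (n * (n - 1) * k ^ 2) + n * m ^ 3 := by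
    have hc : (n : ℝ) * m ^ 3 = ∑ _i : Fin n, m ^ 3 := by simp
    have h : ∑ i, lam i ^ 3 = ∑ i, (lam i - m) ^ 3 + 3 * m * ∑ i, (lam i - m) ^ 2
        + 3 * m ^ 2 * ∑ i, (lam i - m) + n * m ^ 3 := by
      rw [hc, Finset.mul_sum, Finset.mul_sum, ← Finset.sum_add_distrib, ← Finset.sum_add_distrib,
        ← Finset.sum_add_distrib]
      exact Finset.sum_congr rfl fun i _ => by ring
    rw [h, hx, hx2]
    ring
  refine ⟨m, k, hk, (sum_powersetCard_one lam Finset.univ).trans hm, ?_, ?_⟩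
  · have h := sum_powersetCard_two lam Finset.univ
    rw [hm, hP2] at h
    unfold esymm
    linear_combination h / 2
  · have h := sum_powersetCard_three lam Finset.univ
    rw [hm, hP2, hP3] at h
    unfold esymm
    linear_combination h / 6 + hcube / 3

theorem esymm_one_sub_const (n : ℕ) (lam : Fin n → ℝ) (a : ℝ) :
    esymm n 1 (fun i => lam i - a) = esymm n 1 lam - n * a := by
  simp only [esymm, sum_powersetCard_one]
  simp [Finset.sum_sub_distrib]

theorem esymm_two_sub_const (n : ℕ) (lam : Fin n → ℝ) (a : ℝ) :
    esymm n 2 (fun i => lam i - a) =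
      esymm n 2 lam - (n - 1) * a * esymm n 1 lam + n * (n - 1) / 2 * a ^ 2 := by
  have h := sum_powersetCard_two lam Finset.univ
  have h' := sum_powersetCard_two (fun i => lam i - a) Finset.univ
  have hc : (n : ℝ) * a ^ 2 = ∑ _i : Fin n, a ^ 2 := by simp
  have hsq : ∑ i, (lam i - a) ^ 2 = ∑ i, lam i ^ 2 - 2 * a * ∑ i, lam i + n * a ^ 2 := by
    rw [hc, Finset.mul_sum, ← Finset.sum_sub_distrib, ← Finset.sum_add_distrib]
    exact Finset.sum_congr rfl fun i _ => by ring
  have hsum : ∑ i, (lam i - a) = ∑ i, lam i - n * a := by simp [Finset.sum_sub_distrib]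
  rw [hsq, hsum] at h'
  simp only [esymm, sum_powersetCard_one]
  linear_combination (h' - h) / 2

/-- If `λ ∈ Γ₃` satisfies `σ₃(λ) = C₀σ₁(λ)` with `a = (3/(n(n-1)(n-2)))^{1/3}` and
`C₀ = ((n-1)(n-2)/2)a²`, then `μ = λ - a𝟙` satisfies `σ₁(μ) > 0` and
`σ₂(μ) + (n-2)a σ₁(μ) > 0`. -/
theorem shifted_solution_in_tilde_cone_l_eq_one
    (n : ℕ) (hn : 3 ≤ n) (a C₀ : ℝ)
    (ha : a = (3 / ((n : ℝ) * ((n : ℝ) - 1) * ((n : ℝ) - 2))) ^ ((1 : ℝ) / 3))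
    (hC₀ : C₀ = (((n : ℝ) - 1) * ((n : ℝ) - 2) / 2) * a ^ 2)
    (lam : Fin n → ℝ) (hlam : lam ∈ GammaCone n 3)
    (heq : esymm n 3 lam = C₀ * esymm n 1 lam) :
    0 < esymm n 1 (fun i => lam i - a) ∧
    0 < esymm n 2 (fun i => lam i - a)
      + ((n : ℝ) - 2) * a * esymm n 1 (fun i => lam i - a) := by
  have hn' : (3 : ℝ) ≤ n := by exact_mod_cast hn
  have ha0 : 0 < a := by
    rw [ha]
    exact Real.rpow_pos_of_pos (div_pos three_pos
      (mul_pos (mul_pos (by linarith) (by linarith)) (by linarith))) _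
  obtain ⟨m, k, hk, h1, h2, h3⟩ := exists_esymm_eq_and_le hn lam
  have hs1 := hlam 1 le_rfl (by norm_num)
  have hs2 := hlam 2 (by norm_num) (by norm_num)
  rw [h1] at hs1
  rw [h2] at hs2
  have hm : 0 < m := pos_of_mul_pos_right hs1 (by linarith)
  have hp2 : 0 < m ^ 2 - k ^ 2 :=
    pos_of_mul_pos_right hs2 (div_nonneg (mul_nonneg (by linarith) (by linarith)) two_pos.le)
  have hp3 : 3 * a ^ 2 * m ≤ (m - k) ^ 2 * (m + 2 * k) := by
    rw [heq, hC₀, h1] at h3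
    have hpos : 0 < (n : ℝ) * (n - 1) * (n - 2) / 6 :=
      div_pos (mul_pos (mul_pos (by linarith) (by linarith)) (by linarith)) (by norm_num)
    refine le_of_mul_le_mul_left ?_ hpos
    linear_combination h3
  have hnewton : 3 * (a * m) ^ 2 ≤ (m ^ 2 - k ^ 2) ^ 2 := by
    have h := mul_le_mul_of_nonneg_left hp3 hm.le
    have h' := sq_nonneg ((m - k) * k)
    linear_combination h + h'
  have ham : 0 < a * m := mul_pos ha0 hm
  have hp2_gt : a * m < m ^ 2 - k ^ 2 :=
    lt_of_pow_lt_pow_left₀ 2 hp2.le (by nlinarith [pow_pos ham 2])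
  have hma : a < m := lt_of_mul_lt_mul_right (by nlinarith [sq_nonneg k]) hm.le
  rw [esymm_two_sub_const, esymm_one_sub_const, h1, h2]
  constructor
  · nlinarith
  · have hmul1 := mul_pos (show (0 : ℝ) < n - 1 by linarith) (sub_pos.2 hp2_gt)
    have hmul2 := mul_nonneg (mul_nonneg (show (0 : ℝ) ≤ n - 3 by linarith) ha0.le)
      (sub_pos.2 hma).le
    have h := mul_pos (show (0 : ℝ) < n / 2 by linarith) (add_pos_of_pos_of_nonneg hmul1 hmul2)
    linear_combination h
end
end
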